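/- arXiv:1810.06456 — 2 statements merged into one kernel-verified Lean document; each statement's English description precedes it below -/
import Mathlib

section
/- The element 𝒞 is central in U = U_q(sp₄): 𝒞X = X𝒞 for every X ∈ U (equivalently, 𝒞 commutes with each of the generators E₁, E₂, F₁, F₂, K₁, K₁⁻¹, K₂, K₂⁻¹). -/
noncomputable section

open scoped TensorProduct RealInnerProductSpace

/-- The quantum integer `[n]_q = (q^n - q^(-n))/(q - q⁻¹)`. -/
def qnum (q : ℝ) (n : ℤ) : ℝ := (q ^ n - q ^ (-n)) / (q - q⁻¹)

/-- Generators of `U_q(sp₄)` inside an arbitrary ℝ-algebra `U`, together with the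
defining relations of the presented algebra `U_q(sp₄)`. -/
structure Sp4Gens (q : ℝ) (U : Type) [Ring U] [Algebra ℝ U] : Type where
  E1 : U
  E2 : U
  F1 : U
  F2 : U
  K1 : U
  K1i : U
  K2 : U
  K2i : U
  relK1 : K1 * K1i = 1
  relK1' : K1i * K1 = 1
  relK2 : K2 * K2i = 1
  relK2' : K2i * K2 = 1
  relK12 : K1 * K2 = K2 * K1
  relK12i : K1 * K2i = K2i * K1
  relK1i2 : K1i * K2 = K2 * K1i
  relK1i2i : K1i * K2i = K2i * K1i
  relK1E1 : K1 * E1 = (q ^ (2 : ℤ)) • (E1 * K1)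
  relK1E2 : K1 * E2 = (q ^ (-2 : ℤ)) • (E2 * K1)
  relK2E1 : K2 * E1 = (q ^ (-2 : ℤ)) • (E1 * K2)
  relK2E2 : K2 * E2 = (q ^ (4 : ℤ)) • (E2 * K2)
  relK1F1 : K1 * F1 = (q ^ (-2 : ℤ)) • (F1 * K1)
  relK1F2 : K1 * F2 = (q ^ (2 : ℤ)) • (F2 * K1)
  relK2F1 : K2 * F1 = (q ^ (2 : ℤ)) • (F1 * K2)
  relK2F2 : K2 * F2 = (q ^ (-4 : ℤ)) • (F2 * K2)
  relE1F1 : E1 * F1 - F1 * E1 = (q - q⁻¹)⁻¹ • (K1 - K1i)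
  relE2F2 : E2 * F2 - F2 * E2 = (q ^ (2 : ℤ) - q ^ (-2 : ℤ))⁻¹ • (K2 - K2i)
  relE1F2 : E1 * F2 = F2 * E1
  relE2F1 : E2 * F1 = F1 * E2
  serreE1 : E1 ^ 3 * E2 - qnum q 3 • (E1 ^ 2 * E2 * E1) + qnum q 3 • (E1 * E2 * E1 ^ 2)
      - E2 * E1 ^ 3 = 0
  serreE2 : E2 ^ 2 * E1 - (q ^ (2 : ℤ) + q ^ (-2 : ℤ)) • (E2 * E1 * E2) + E1 * E2 ^ 2 = 0
  serreF1 : F1 ^ 3 * F2 - qnum q 3 • (F1 ^ 2 * F2 * F1) + qnum q 3 • (F1 * F2 * F1 ^ 2)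
      - F2 * F1 ^ 3 = 0
  serreF2 : F2 ^ 2 * F1 - (q ^ (2 : ℤ) + q ^ (-2 : ℤ)) • (F2 * F1 * F2) + F1 * F2 ^ 2 = 0

variable {q : ℝ} {U : Type} [Ring U] [Algebra ℝ U]

/-- The quantum root vector `E_{β₁} = E₁`. -/
def Eb1 (g : Sp4Gens q U) : U := g.E1

/-- The quantum root vector `E_{β₂}`. -/
def Eb2 (g : Sp4Gens q U) : U :=
  (qnum q 2)⁻¹ • (g.E1 ^ 2 * g.E2) - q⁻¹ • (g.E1 * g.E2 * g.E1)
    + (q ^ (-2 : ℤ) * (qnum q 2)⁻¹) • (g.E2 * g.E1 ^ 2)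

/-- The quantum root vector `E_{β₃}`. -/
def Eb3 (g : Sp4Gens q U) : U := g.E1 * g.E2 - (q ^ (-2 : ℤ)) • (g.E2 * g.E1)

/-- The quantum root vector `E_{β₄} = E₂`. -/
def Eb4 (g : Sp4Gens q U) : U := g.E2

/-- `E_{β₁}* = F₁K₁`, the image of `E_{β₁}` under the star anti-automorphism
(the star is the unique ℝ-linear anti-automorphism with `Eᵢ* = FᵢKᵢ`, `Fᵢ* = Kᵢ⁻¹Eᵢ`,
`Kᵢ* = Kᵢ`; on the elements below its value is forced by anti-multiplicativity). -/
def sEb1 (g : Sp4Gens q U) : U := g.F1 * g.K1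

/-- `E_{β₂}*`, the image of `E_{β₂}` under the star anti-automorphism. -/
def sEb2 (g : Sp4Gens q U) : U :=
  (qnum q 2)⁻¹ • (g.F2 * g.K2 * (g.F1 * g.K1) ^ 2)
    - q⁻¹ • (g.F1 * g.K1 * (g.F2 * g.K2) * (g.F1 * g.K1))
    + (q ^ (-2 : ℤ) * (qnum q 2)⁻¹) • ((g.F1 * g.K1) ^ 2 * (g.F2 * g.K2))

/-- `E_{β₃}*`, the image of `E_{β₃}` under the star anti-automorphism. -/
def sEb3 (g : Sp4Gens q U) : U :=
  g.F2 * g.K2 * (g.F1 * g.K1) - (q ^ (-2 : ℤ)) • (g.F1 * g.K1 * (g.F2 * g.K2))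

/-- `E_{β₄}* = F₂K₂`, the image of `E_{β₄}` under the star anti-automorphism. -/
def sEb4 (g : Sp4Gens q U) : U := g.F2 * g.K2

/-- The quantized Levi factor `U_q(𝔩)`, i.e. the unital subalgebra generated by
`E₁, F₁, K₁, K₁⁻¹, K₂, K₂⁻¹`. -/
def Uql (g : Sp4Gens q U) : Subalgebra ℝ U :=
  Algebra.adjoin ℝ {g.E1, g.F1, g.K1, g.K1i, g.K2, g.K2i}

/-- The classical part `𝒞_c` of the Casimir element. -/
def CasC (g : Sp4Gens q U) : U :=
  ((q - q⁻¹) ^ 2)⁻¹ •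
      ((q ^ (-4 : ℤ)) • (g.K1i ^ 2 * g.K2i) + (q ^ (-2 : ℤ)) • g.K2i
        + (q ^ (2 : ℤ)) • g.K2 + (q ^ (4 : ℤ)) • (g.K1 ^ 2 * g.K2))
    + sEb1 g * Eb1 g * ((q ^ (-5 : ℤ)) • (g.K1i ^ 2 * g.K2i) + q • g.K2)
    + (qnum q 2 ^ 2 * q ^ (-6 : ℤ)) • (sEb2 g * Eb2 g * (g.K1i ^ 2 * g.K2i))
    + sEb3 g * Eb3 g * ((q ^ (-7 : ℤ)) • (g.K1i ^ 2 * g.K2i) + q⁻¹ • g.K2i)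
    + (qnum q 2 ^ 2 * q ^ (-4 : ℤ)) • (sEb4 g * Eb4 g * g.K2i)

/-- The quantum part `𝒞_q` of the Casimir element. -/
def CasQ (g : Sp4Gens q U) : U :=
  -(((q - q⁻¹) * qnum q 2 * q ^ (-5 : ℤ)) •
      ((sEb1 g * sEb3 g * Eb2 g + sEb2 g * Eb3 g * Eb1 g) * (g.K1i ^ 2 * g.K2i)))
    - ((q - q⁻¹) * qnum q 2 * q ^ (-7 : ℤ)) •
        ((sEb1 g * sEb4 g * Eb3 g + sEb3 g * Eb4 g * Eb1 g) * (g.K1i ^ 2 * g.K2i))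
    + ((q - q⁻¹) ^ 2 * q ^ (-4 : ℤ)) •
        (sEb1 g * sEb3 g * Eb3 g * Eb1 g * (g.K1i ^ 2 * g.K2i))
    + ((q - q⁻¹) ^ 2 * qnum q 2 ^ 2 * q ^ (-7 : ℤ)) •
        (sEb1 g * sEb4 g * Eb4 g * Eb1 g * (g.K1i ^ 2 * g.K2i))

/-- The Casimir element `𝒞 = 𝒞_c + 𝒞_q`. -/
def Cas (g : Sp4Gens q U) : U := CasC g + CasQ g

set_option linter.unusedSectionVars false
set_option linter.unusedSimpArgs false
set_option linter.unusedVariables false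

/-- The right-multiplied Casimir polynomial `𝒞 K₁² K₂`, in terms of `a = E₁*`, `b = E₂*`,
`E = E₁`, `e = E₂`, `x = K₁²`, `y = K₂²`. -/
def casPoly (q : ℝ) (a b E e x y : U) : U :=
  let t : ℝ := q + q⁻¹
  let Q : ℝ := q - q⁻¹
  let E2 : U := t⁻¹ • (E * E * e) - q⁻¹ • (E * e * E) + (q⁻¹ ^ 2 * t⁻¹) • (e * E * E)
  let S2 : U := t⁻¹ • (b * a * a) - q⁻¹ • (a * b * a) + (q⁻¹ ^ 2 * t⁻¹) • (a * a * b)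
  let E3 : U := E * e - (q⁻¹ ^ 2) • (e * E)
  let S3 : U := b * a - (q⁻¹ ^ 2) • (a * b)
  (Q ^ 2)⁻¹ • ((q⁻¹ ^ 4) • (1 : U) + (q⁻¹ ^ 2) • x + (q ^ 2) • (x * y) + (q ^ 4) • (x * x * y))
    + a * E * ((q⁻¹ ^ 5) • (1 : U) + q • (x * y))
    + (t ^ 2 * q⁻¹ ^ 6) • (S2 * E2)
    + S3 * E3 * ((q⁻¹ ^ 7) • (1 : U) + q⁻¹ • x)
    + (t ^ 2 * q⁻¹ ^ 4) • (b * e * x)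
    - (Q * t * q⁻¹ ^ 5) • (a * S3 * E2 + S2 * E3 * E)
    - (Q * t * q⁻¹ ^ 7) • (a * b * E3 + S3 * e * E)
    + (Q ^ 2 * q⁻¹ ^ 4) • (a * S3 * E3 * E)
    + (Q ^ 2 * t ^ 2 * q⁻¹ ^ 7) • (a * b * e * E)

/-- The relations between `a = E₁*`, `b = E₂*`, `E = E₁`, `e = E₂`, `x = K₁²`, `y = K₂²`. -/
structure CoreRels (q : ℝ) (a b E e x y : U) : Prop where
  Ea : E * a = (q⁻¹ ^ 2) • (a * E) + (q - q⁻¹)⁻¹ • (x - 1)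
  eb : e * b = (q⁻¹ ^ 4) • (b * e) + ((q - q⁻¹) * (q + q⁻¹))⁻¹ • (y - 1)
  Eb : E * b = (q ^ 2) • (b * E)
  ea : e * a = (q ^ 2) • (a * e)
  xE : x * E = (q ^ 4) • (E * x)
  xe : x * e = (q⁻¹ ^ 4) • (e * x)
  yE : y * E = (q⁻¹ ^ 4) • (E * y)
  ye : y * e = (q ^ 8) • (e * y)
  xa : x * a = (q⁻¹ ^ 4) • (a * x)
  xb : x * b = (q ^ 4) • (b * x)
  ya : y * a = (q ^ 4) • (a * y)
  yb : y * b = (q⁻¹ ^ 8) • (b * y)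
  yx : y * x = x * y
  serE1 : E * (E * (E * e)) = (q ^ 2 + 1 + q⁻¹ ^ 2) • (E * (E * (e * E)))
    - (q ^ 2 + 1 + q⁻¹ ^ 2) • (E * (e * (E * E))) + e * (E * (E * E))
  serE2 : E * (e * e) = (q ^ 2 + q⁻¹ ^ 2) • (e * (E * e)) - e * (e * E)
  sera1 : a * (a * (a * b)) = (q ^ 2 + 1 + q⁻¹ ^ 2) • (a * (a * (b * a)))
    - (q ^ 2 + 1 + q⁻¹ ^ 2) • (a * (b * (a * a))) + b * (a * (a * a))
  sera2 : a * (b * b) = (q ^ 2 + q⁻¹ ^ 2) • (b * (a * b)) - b * (b * a)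

/-- Left-multiplied form of a rewriting rule for words of length two. -/
theorem rule_assoc {u v w : U} (h : u * v = w) (z : U) : u * (v * z) = w * z := by
  rw [← mul_assoc, h]

/-- Left-multiplied form of a rewriting rule for words of length three. -/
theorem rule_assoc3 {u v s w : U} (h : u * (v * s) = w) (z : U) :
    u * (v * (s * z)) = w * z := by
  rw [← h]; simp only [mul_assoc]

/-- Left-multiplied form of a rewriting rule for words of length four. -/
theorem rule_assoc4 {u v s t w : U} (h : u * (v * (s * t)) = w) (z : U) :
    u * (v * (s * (t * z))) = w * z := by
  rw [← h]; simp only [mul_assoc]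

set_option maxHeartbeats 4000000 in
theorem core_E (hq0 : 0 < q) (hq1 : q < 1) {a b E e x y : U} (h : CoreRels q a b E e x y) :
    (q⁻¹ ^ 2) • (casPoly q a b E e x y * E) = E * casPoly q a b E e x y := by
  have h0 : q ≠ 0 := hq0.ne'
  have h1 : q ^ 2 - 1 ≠ 0 := by nlinarith
  have h2 : q ^ 2 + 1 ≠ 0 := by positivity
  have ht : q + q⁻¹ = (q ^ 2 + 1) / q := by field_simp
  have hQ : q - q⁻¹ = (q ^ 2 - 1) / q := by field_simp
  obtain ⟨Ea, eb, Eb, ea, xE, xe, yE, ye, xa, xb, ya, yb, yx, s1, s2, s3, s4⟩ := h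
  simp only [casPoly, mul_add, add_mul, mul_sub, sub_mul, smul_add, smul_sub, mul_smul_comm,
    smul_mul_assoc, mul_assoc, mul_one, one_mul, smul_smul,
    Ea, eb, Eb, ea, xE, xe, yE, ye, xa, xb, ya, yb, yx, s1, s2, s3, s4,
    rule_assoc Ea, rule_assoc eb, rule_assoc Eb, rule_assoc ea, rule_assoc xE, rule_assoc xe,
    rule_assoc yE, rule_assoc ye, rule_assoc xa, rule_assoc xb, rule_assoc ya, rule_assoc yb,
    rule_assoc yx, rule_assoc4 s1, rule_assoc3 s2, rule_assoc4 s3, rule_assoc3 s4]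
  simp only [ht, hQ]
  match_scalars <;> field_simp <;> ring

set_option maxHeartbeats 4000000 in
theorem core_e (hq0 : 0 < q) (hq1 : q < 1) {a b E e x y : U} (h : CoreRels q a b E e x y) :
    casPoly q a b E e x y * e = e * casPoly q a b E e x y := by
  have h0 : q ≠ 0 := hq0.ne'
  have h1 : q ^ 2 - 1 ≠ 0 := by nlinarith
  have h2 : q ^ 2 + 1 ≠ 0 := by positivity
  have ht : q + q⁻¹ = (q ^ 2 + 1) / q := by field_simp
  have hQ : q - q⁻¹ = (q ^ 2 - 1) / q := by field_simp
  obtain ⟨Ea, eb, Eb, ea, xE, xe, yE, ye, xa, xb, ya, yb, yx, s1, s2, s3, s4⟩ := h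
  simp only [casPoly, mul_add, add_mul, mul_sub, sub_mul, smul_add, smul_sub, mul_smul_comm,
    smul_mul_assoc, mul_assoc, mul_one, one_mul, smul_smul,
    Ea, eb, Eb, ea, xE, xe, yE, ye, xa, xb, ya, yb, yx, s1, s2, s3, s4,
    rule_assoc Ea, rule_assoc eb, rule_assoc Eb, rule_assoc ea, rule_assoc xE, rule_assoc xe,
    rule_assoc yE, rule_assoc ye, rule_assoc xa, rule_assoc xb, rule_assoc ya, rule_assoc yb,
    rule_assoc yx, rule_assoc4 s1, rule_assoc3 s2, rule_assoc4 s3, rule_assoc3 s4]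
  simp only [ht, hQ]
  match_scalars <;> field_simp <;> ring

set_option maxHeartbeats 4000000 in
theorem core_a (hq0 : 0 < q) (hq1 : q < 1) {a b E e x y : U} (h : CoreRels q a b E e x y) :
    (q ^ 2) • (casPoly q a b E e x y * a) = a * casPoly q a b E e x y := by
  have h0 : q ≠ 0 := hq0.ne'
  have h1 : q ^ 2 - 1 ≠ 0 := by nlinarith
  have h2 : q ^ 2 + 1 ≠ 0 := by positivity
  have ht : q + q⁻¹ = (q ^ 2 + 1) / q := by field_simp
  have hQ : q - q⁻¹ = (q ^ 2 - 1) / q := by field_simp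
  obtain ⟨Ea, eb, Eb, ea, xE, xe, yE, ye, xa, xb, ya, yb, yx, s1, s2, s3, s4⟩ := h
  simp only [casPoly, mul_add, add_mul, mul_sub, sub_mul, smul_add, smul_sub, mul_smul_comm,
    smul_mul_assoc, mul_assoc, mul_one, one_mul, smul_smul,
    Ea, eb, Eb, ea, xE, xe, yE, ye, xa, xb, ya, yb, yx, s1, s2, s3, s4,
    rule_assoc Ea, rule_assoc eb, rule_assoc Eb, rule_assoc ea, rule_assoc xE, rule_assoc xe,
    rule_assoc yE, rule_assoc ye, rule_assoc xa, rule_assoc xb, rule_assoc ya, rule_assoc yb,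
    rule_assoc yx, rule_assoc4 s1, rule_assoc3 s2, rule_assoc4 s3, rule_assoc3 s4]
  simp only [ht, hQ]
  match_scalars <;> field_simp <;> ring

set_option maxHeartbeats 4000000 in
theorem core_b (hq0 : 0 < q) (hq1 : q < 1) {a b E e x y : U} (h : CoreRels q a b E e x y) :
    casPoly q a b E e x y * b = b * casPoly q a b E e x y := by
  have h0 : q ≠ 0 := hq0.ne'
  have h1 : q ^ 2 - 1 ≠ 0 := by nlinarith
  have h2 : q ^ 2 + 1 ≠ 0 := by positivity
  have ht : q + q⁻¹ = (q ^ 2 + 1) / q := by field_simp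
  have hQ : q - q⁻¹ = (q ^ 2 - 1) / q := by field_simp
  obtain ⟨Ea, eb, Eb, ea, xE, xe, yE, ye, xa, xb, ya, yb, yx, s1, s2, s3, s4⟩ := h
  simp only [casPoly, mul_add, add_mul, mul_sub, sub_mul, smul_add, smul_sub, mul_smul_comm,
    smul_mul_assoc, mul_assoc, mul_one, one_mul, smul_smul,
    Ea, eb, Eb, ea, xE, xe, yE, ye, xa, xb, ya, yb, yx, s1, s2, s3, s4,
    rule_assoc Ea, rule_assoc eb, rule_assoc Eb, rule_assoc ea, rule_assoc xE, rule_assoc xe,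
    rule_assoc yE, rule_assoc ye, rule_assoc xa, rule_assoc xb, rule_assoc ya, rule_assoc yb,
    rule_assoc yx, rule_assoc4 s1, rule_assoc3 s2, rule_assoc4 s3, rule_assoc3 s4]
  simp only [ht, hQ]
  match_scalars <;> field_simp <;> ring

/-- A weight-zero argument: an element which `q`-commutes with the generators commutes with the
Casimir polynomial. -/
theorem core_k {a b E e x y k : U} {c d : ℝ} (hc : c ≠ 0) (hd : d ≠ 0)
    (ka : k * a = c⁻¹ • (a * k)) (kb : k * b = d⁻¹ • (b * k))
    (kE : k * E = c • (E * k)) (ke : k * e = d • (e * k))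
    (kx : k * x = x * k) (ky : k * y = y * k) :
    casPoly q a b E e x y * k = k * casPoly q a b E e x y := by
  simp only [casPoly, mul_add, add_mul, mul_sub, sub_mul, smul_add, smul_sub, mul_smul_comm,
    smul_mul_assoc, mul_assoc, mul_one, one_mul, smul_smul, ka, kb, kE, ke, kx, ky,
    rule_assoc ka, rule_assoc kb, rule_assoc kE, rule_assoc ke, rule_assoc kx, rule_assoc ky]
  match_scalars <;> field_simp

/-- Commutation rule for the inverse of a `q`-commuting element. -/
theorem inv_rule {k ki z : U} {c : ℝ} (hc : c ≠ 0) (h1 : k * ki = 1) (h2 : ki * k = 1)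
    (h : k * z = c • (z * k)) : ki * z = c⁻¹ • (z * ki) := by
  have h3 : z * k = c⁻¹ • (k * z) := by rw [h, smul_smul, inv_mul_cancel₀ hc, one_smul]
  calc ki * z = ki * (z * k) * ki := by rw [mul_assoc, mul_assoc, h1, mul_one]
    _ = c⁻¹ • (z * ki) := by
      rw [h3, mul_smul_comm, smul_mul_assoc, ← mul_assoc, h2, one_mul]

theorem qnum_two (hq0 : 0 < q) (hq1 : q < 1) : qnum q 2 = q + q⁻¹ := by
  have h0 : q ≠ 0 := hq0.ne'
  have h1 : q ^ 2 - 1 ≠ 0 := by nlinarith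
  have hQ : q - q⁻¹ = (q ^ 2 - 1) / q := by field_simp
  rw [qnum, hQ]; simp only [zpow_neg]; norm_cast; field_simp; ring

theorem qnum_three (hq0 : 0 < q) (hq1 : q < 1) : qnum q 3 = q ^ 2 + 1 + q⁻¹ ^ 2 := by
  have h0 : q ≠ 0 := hq0.ne'
  have h1 : q ^ 2 - 1 ≠ 0 := by nlinarith
  have hQ : q - q⁻¹ = (q ^ 2 - 1) / q := by field_simp
  rw [qnum, hQ]; simp only [zpow_neg]; norm_cast; field_simp; ring

theorem zpow_neg_natCast_eq (q : ℝ) (n : ℕ) : q ^ (-(n : ℤ)) = q⁻¹ ^ n := by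
  rw [zpow_neg, zpow_natCast, inv_pow]

set_option maxHeartbeats 4000000 in
theorem coreRels_of_gens (hq0 : 0 < q) (hq1 : q < 1) (g : Sp4Gens q U) :
    CoreRels q (sEb1 g) (sEb4 g) (Eb1 g) (Eb4 g) (g.K1 * g.K1) (g.K2 * g.K2) := by
  have h0 : q ≠ 0 := hq0.ne'
  have h1 : q ^ 2 - 1 ≠ 0 := by nlinarith
  have h2 : q ^ 2 + 1 ≠ 0 := by positivity
  have ht : q + q⁻¹ = (q ^ 2 + 1) / q := by field_simp
  have hQ : q - q⁻¹ = (q ^ 2 - 1) / q := by field_simp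
  have hQ2 : q ^ (2 : ℤ) - q ^ (-2 : ℤ) = (q ^ 2 - 1) * (q ^ 2 + 1) / q ^ 2 := by
    rw [zpow_neg]; norm_cast; field_simp; ring
  obtain ⟨E1, E2, F1, F2, K1, K1i, K2, K2i, r1, rp1, r2, rp2, r12, r12i, r1i2, r1i2i,
    K1E1, K1E2, K2E1, K2E2, K1F1, K1F2, K2F1, K2F2, E1F1, E2F2, E1F2, E2F1, se1, se2, sf1, sf2⟩ := g
  have z2 : q ^ (-2 : ℤ) = q⁻¹ ^ 2 := zpow_neg_natCast_eq q 2
  have z4 : q ^ (-4 : ℤ) = q⁻¹ ^ 4 := zpow_neg_natCast_eq q 4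
  have y2 : q ^ (2 : ℤ) = q ^ 2 := zpow_natCast q 2
  have y4 : q ^ (4 : ℤ) = q ^ 4 := zpow_natCast q 4
  rw [hQ2] at E2F2
  rw [hQ] at E1F1
  rw [qnum_three hq0 hq1] at se1 sf1
  rw [z2, y2] at se2 sf2
  rw [z2] at K1E2 K2E1 K1F1
  rw [y2] at K1E1 K1F2 K2F1
  rw [y4] at K2E2
  rw [z4] at K2F2
  have e11 : E1 * F1 = F1 * E1 + ((q ^ 2 - 1) / q)⁻¹ • (K1 - K1i) := by rw [← E1F1]; abel
  have e22 : E2 * F2 = F2 * E2 + ((q ^ 2 - 1) * (q ^ 2 + 1) / q ^ 2)⁻¹ • (K2 - K2i) := by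
    rw [← E2F2]; abel
  simp only [pow_three E1, pow_two E1, pow_two E2, mul_assoc] at se1 se2
  simp only [pow_three F1, pow_two F1, pow_two F2, mul_assoc] at sf1 sf2
  have f1 : F1 * (F1 * (F1 * F2)) = (q ^ 2 + 1 + q⁻¹ ^ 2) • (F1 * (F1 * (F2 * F1)))
      - (q ^ 2 + 1 + q⁻¹ ^ 2) • (F1 * (F2 * (F1 * F1))) + F2 * (F1 * (F1 * F1)) := by
    rw [← sub_eq_zero, ← sf1]; module
  have f2 : F1 * (F2 * F2) = (q ^ 2 + q⁻¹ ^ 2) • (F2 * (F1 * F2)) - F2 * (F2 * F1) := by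
    rw [← sub_eq_zero, ← sf2]; module
  simp only [sEb1, sEb4, Eb1, Eb4]
  constructor
  case serE1 => rw [← sub_eq_zero, ← se1]; module
  case serE2 => rw [← sub_eq_zero, ← se2]; module
  all_goals
    simp only [mul_add, add_mul, mul_sub, sub_mul, smul_add, smul_sub, mul_smul_comm,
      smul_mul_assoc, mul_assoc, mul_one, one_mul, smul_smul,
      rp1, rp2, r12.symm, K1E1, K1E2, K2E1, K2E2, K1F1, K1F2, K2F1, K2F2, e11, e22, E1F2, E2F1,
      rule_assoc r12.symm, rule_assoc K1E1, rule_assoc K1E2, rule_assoc K2E1, rule_assoc K2E2,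
      rule_assoc K1F1, rule_assoc K1F2, rule_assoc K2F1, rule_assoc K2F2, rule_assoc e11,
      rule_assoc e22, rule_assoc E1F2, rule_assoc E2F1,
      f1, f2, rule_assoc4 f1, rule_assoc3 f2]
    try simp only [ht, hQ]
    try (match_scalars <;> field_simp)

/-- `M = K₁⁻² K₂⁻¹`; the Casimir element is `casPoly * M`. -/
theorem cas_eq (hq0 : 0 < q) (hq1 : q < 1) (g : Sp4Gens q U) :
    Cas g = casPoly q (sEb1 g) (sEb4 g) (Eb1 g) (Eb4 g) (g.K1 * g.K1) (g.K2 * g.K2)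
      * (g.K1i * g.K1i * g.K2i) := by
  have h0 : q ≠ 0 := hq0.ne'
  have h1 : q ^ 2 - 1 ≠ 0 := by nlinarith
  have h2 : q ^ 2 + 1 ≠ 0 := by positivity
  have ht : q + q⁻¹ = (q ^ 2 + 1) / q := by field_simp
  have hQ : q - q⁻¹ = (q ^ 2 - 1) / q := by field_simp
  have z2 : q ^ (-2 : ℤ) = q⁻¹ ^ 2 := zpow_neg_natCast_eq q 2
  have z4 : q ^ (-4 : ℤ) = q⁻¹ ^ 4 := zpow_neg_natCast_eq q 4
  have z5 : q ^ (-5 : ℤ) = q⁻¹ ^ 5 := zpow_neg_natCast_eq q 5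
  have z6 : q ^ (-6 : ℤ) = q⁻¹ ^ 6 := zpow_neg_natCast_eq q 6
  have z7 : q ^ (-7 : ℤ) = q⁻¹ ^ 7 := zpow_neg_natCast_eq q 7
  have y2 : q ^ (2 : ℤ) = q ^ 2 := zpow_natCast q 2
  have y4 : q ^ (4 : ℤ) = q ^ 4 := zpow_natCast q 4
  have u1 : g.K2i = g.K1 * (g.K1 * (g.K1i * (g.K1i * g.K2i))) := by
    rw [rule_assoc g.relK1, one_mul, rule_assoc g.relK1, one_mul]
  have u2 : g.K2 = g.K1 * (g.K1 * (g.K2 * (g.K2 * (g.K1i * (g.K1i * g.K2i))))) := by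
    simp only [g.relK1i2.symm, rule_assoc g.relK1i2.symm, mul_assoc,
      rule_assoc g.relK1, g.relK2, mul_one, one_mul]
  have v2 : Eb2 g = (q + q⁻¹)⁻¹ • (Eb1 g * Eb1 g * Eb4 g) - q⁻¹ • (Eb1 g * Eb4 g * Eb1 g)
      + (q⁻¹ ^ 2 * (q + q⁻¹)⁻¹) • (Eb4 g * Eb1 g * Eb1 g) := by
    simp only [Eb2, Eb1, Eb4, qnum_two hq0 hq1, z2, pow_two g.E1, mul_assoc]
  have w2 : sEb2 g = (q + q⁻¹)⁻¹ • (sEb4 g * sEb1 g * sEb1 g) - q⁻¹ • (sEb1 g * sEb4 g * sEb1 g)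
      + (q⁻¹ ^ 2 * (q + q⁻¹)⁻¹) • (sEb1 g * sEb1 g * sEb4 g) := by
    simp only [sEb2, sEb1, sEb4, qnum_two hq0 hq1, z2, pow_two (g.F1 * g.K1), mul_assoc]
  have v3 : Eb3 g = Eb1 g * Eb4 g - (q⁻¹ ^ 2) • (Eb4 g * Eb1 g) := by
    simp only [Eb3, Eb1, Eb4, z2]
  have w3 : sEb3 g = sEb4 g * sEb1 g - (q⁻¹ ^ 2) • (sEb1 g * sEb4 g) := by
    simp only [sEb3, sEb1, sEb4, z2]
  simp only [Cas, CasC, CasQ, casPoly, ← v2, ← w2, ← v3, ← w3, qnum_two hq0 hq1,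
    z2, z4, z5, z6, z7, y2, y4, pow_two g.K1i, pow_two g.K1]
  generalize sEb1 g = a, sEb4 g = b, Eb1 g = E, Eb4 g = e, sEb2 g = S2, sEb3 g = S3,
    Eb2 g = E2, Eb3 g = E3
  simp only [mul_add, add_mul, mul_sub, sub_mul, smul_add, smul_sub, mul_smul_comm,
      smul_mul_assoc, mul_assoc, mul_one, one_mul, smul_smul, ← u1, ← u2]
  module

/-- If `M` and `P` twist `z` by opposite factors then `P * M` commutes with `z`. -/
theorem commute_of_twist {P M z : U} {c : ℝ} (hM : M * z = c • (z * M))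
    (hP : c • (P * z) = z * P) : Commute (P * M) z := by
  have : P * M * z = z * (P * M) := by
    rw [mul_assoc, hM, mul_smul_comm, ← mul_assoc P, ← smul_mul_assoc, hP, mul_assoc]
  exact this

/-- the element `𝒞` is central in `U_q(sp₄)`. -/
theorem casimir_is_central (hq0 : 0 < q) (hq1 : q < 1) (g : Sp4Gens q U) :
    ∀ X ∈ Algebra.adjoin ℝ
        ({g.E1, g.E2, g.F1, g.F2, g.K1, g.K1i, g.K2, g.K2i} : Set U),
      Cas g * X = X * Cas g := by
  have h0 : q ≠ 0 := hq0.ne'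
  have H := coreRels_of_gens hq0 hq1 g
  have hC := cas_eq hq0 hq1 g
  have z2 : q ^ (-2 : ℤ) = (q ^ 2)⁻¹ := by rw [zpow_neg]; norm_cast
  have z4 : q ^ (-4 : ℤ) = (q ^ 4)⁻¹ := by rw [zpow_neg]; norm_cast
  have y2 : q ^ (2 : ℤ) = q ^ 2 := zpow_natCast q 2
  have y4 : q ^ (4 : ℤ) = q ^ 4 := zpow_natCast q 4
  have K1E1 := g.relK1E1
  have K1E2 := g.relK1E2
  have K2E1 := g.relK2E1
  have K2E2 := g.relK2E2
  have K1F1 := g.relK1F1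
  have K1F2 := g.relK1F2
  have K2F1 := g.relK2F1
  have K2F2 := g.relK2F2
  simp only [z2, z4, y2, y4] at K1E1 K1E2 K2E1 K2E2 K1F1 K1F2 K2F1 K2F2
  have K1a : g.K1 * sEb1 g = (q ^ 2)⁻¹ • (sEb1 g * g.K1) := by
    simp only [sEb1]; rw [← mul_assoc, K1F1, smul_mul_assoc]
  have K2a : g.K2 * sEb1 g = (q ^ 2) • (sEb1 g * g.K2) := by
    simp only [sEb1]; rw [← mul_assoc, K2F1, smul_mul_assoc, mul_assoc, mul_assoc, g.relK12]
  have K1b : g.K1 * sEb4 g = (q ^ 2) • (sEb4 g * g.K1) := by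
    simp only [sEb4]; rw [← mul_assoc, K1F2, smul_mul_assoc, mul_assoc, mul_assoc, g.relK12]
  have K2b : g.K2 * sEb4 g = (q ^ 4)⁻¹ • (sEb4 g * g.K2) := by
    simp only [sEb4]; rw [← mul_assoc, K2F2, smul_mul_assoc]
  have n2 : q ^ 2 ≠ 0 := pow_ne_zero _ h0
  have n4 : q ^ 4 ≠ 0 := pow_ne_zero _ h0
  have I1E1 := inv_rule n2 g.relK1 g.relK1' K1E1
  have I1E2 := inv_rule (inv_ne_zero n2) g.relK1 g.relK1' K1E2
  have I2E1 := inv_rule (inv_ne_zero n2) g.relK2 g.relK2' K2E1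
  have I2E2 := inv_rule n4 g.relK2 g.relK2' K2E2
  have I1a := inv_rule (inv_ne_zero n2) g.relK1 g.relK1' K1a
  have I1b := inv_rule n2 g.relK1 g.relK1' K1b
  have I2a := inv_rule n2 g.relK2 g.relK2' K2a
  have I2b := inv_rule (inv_ne_zero n4) g.relK2 g.relK2' K2b
  have ME1 : g.K1i * g.K1i * g.K2i * g.E1 = (q⁻¹ ^ 2) • (g.E1 * (g.K1i * g.K1i * g.K2i)) := by
    simp only [mul_assoc, mul_smul_comm, smul_mul_assoc, I2E1, I1E1, rule_assoc I1E1, smul_smul]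
    match_scalars; field_simp
  have ME2 : g.K1i * g.K1i * g.K2i * g.E2 = g.E2 * (g.K1i * g.K1i * g.K2i) := by
    simp only [mul_assoc, mul_smul_comm, smul_mul_assoc, I2E2, I1E2, rule_assoc I1E2, smul_smul]
    match_scalars; field_simp
  have Ma : g.K1i * g.K1i * g.K2i * sEb1 g = (q ^ 2) • (sEb1 g * (g.K1i * g.K1i * g.K2i)) := by
    simp only [mul_assoc, mul_smul_comm, smul_mul_assoc, I2a, I1a, rule_assoc I1a, smul_smul]
    match_scalars; field_simp
  have Mb : g.K1i * g.K1i * g.K2i * sEb4 g = sEb4 g * (g.K1i * g.K1i * g.K2i) := by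
    simp only [mul_assoc, mul_smul_comm, smul_mul_assoc, I2b, I1b, rule_assoc I1b, smul_smul]
    match_scalars; field_simp
  have c12 : Commute g.K1 g.K2 := g.relK12
  have c12i : Commute g.K1 g.K2i := g.relK12i
  have c1i2 : Commute g.K1i g.K2 := g.relK1i2
  have c11 : Commute g.K1 g.K1i := g.relK1.trans g.relK1'.symm
  have c22 : Commute g.K2 g.K2i := g.relK2.trans g.relK2'.symm
  have hE1 : Commute (Cas g) g.E1 := by
    rw [hC]
    exact commute_of_twist ME1 (core_E hq0 hq1 H)
  have hE2 : Commute (Cas g) g.E2 := by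
    rw [hC]
    exact commute_of_twist (c := 1) (by rw [one_smul]; exact ME2) (by rw [one_smul]; exact core_e hq0 hq1 H)
  have ha : Commute (Cas g) (sEb1 g) := by
    rw [hC]
    exact commute_of_twist Ma (core_a hq0 hq1 H)
  have hb : Commute (Cas g) (sEb4 g) := by
    rw [hC]
    exact commute_of_twist (c := 1) (by rw [one_smul]; exact Mb) (by rw [one_smul]; exact core_b hq0 hq1 H)
  have hK1 : Commute (Cas g) g.K1 := by
    rw [hC]
    refine Commute.mul_left ?_ ((c11.mul_right c11).mul_right c12i).symm
    exact core_k n2 (inv_ne_zero n2) K1a (by rw [inv_inv]; exact K1b) K1E1 K1E2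
      (mul_assoc _ _ _).symm (c12.mul_right c12)
  have hK2 : Commute (Cas g) g.K2 := by
    rw [hC]
    refine Commute.mul_left ?_ ((c1i2.symm.mul_right c1i2.symm).mul_right c22).symm
    exact core_k (inv_ne_zero n2) n4 (by rw [inv_inv]; exact K2a) K2b K2E1 K2E2
      (c12.symm.mul_right c12.symm) (mul_assoc _ _ _).symm
  have hinv : ∀ k ki : U, k * ki = 1 → ki * k = 1 → Commute (Cas g) k → Commute (Cas g) ki := by
    intro k ki h1 h2 hk
    have := inv_rule (c := 1) one_ne_zero h1 h2 (z := Cas g) (by rw [one_smul]; exact hk.symm)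
    rw [inv_one, one_smul] at this
    exact this.symm
  have hK1i := hinv _ _ g.relK1 g.relK1' hK1
  have hK2i := hinv _ _ g.relK2 g.relK2' hK2
  have hF1 : Commute (Cas g) g.F1 := by
    have : g.F1 = sEb1 g * g.K1i := by rw [sEb1, mul_assoc, g.relK1, mul_one]
    rw [this]; exact ha.mul_right hK1i
  have hF2 : Commute (Cas g) g.F2 := by
    have : g.F2 = sEb4 g * g.K2i := by rw [sEb4, mul_assoc, g.relK2, mul_one]
    rw [this]; exact hb.mul_right hK2i
  intro X hX
  have key : Commute (Cas g) X := by
    induction hX using Algebra.adjoin_induction with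
    | mem z hz =>
      simp only [Set.mem_insert_iff, Set.mem_singleton_iff] at hz
      rcases hz with rfl | rfl | rfl | rfl | rfl | rfl | rfl | rfl <;> assumption
    | algebraMap r => exact (Algebra.commutes r (Cas g)).symm
    | add _ _ _ _ h1 h2 => exact h1.add_right h2
    | mul _ _ _ _ h1 h2 => exact h1.mul_right h2
  exact key
end
end

section
/- In U = U_q(sp₄) the following six elements belong to the subalgebra U_q(𝔩): E_{ξ₁}E_{ξ₁}* − q⁻⁴E_{ξ₁}*E_{ξ₁} + Qq⁻²E_{ξ₂}*E_{ξ₂} − Q²[2]_q q⁻³E_{ξ₃}*E_{ξ₃}; E_{ξ₂}E_{ξ₂}* − q⁻²E_{ξ₂}*E_{ξ₂} + Q[2]_q²q⁻⁴E_{ξ₃}*E_{ξ₃}; E_{ξ₃}E_{ξ₃}* − q⁻⁴E_{ξ₃}*E_{ξ₃}; E_{ξ₁}E_{ξ₂}* − q⁻²E_{ξ₂}*E_{ξ₁} + Q[2]_q q⁻²E_{ξ₃}*E_{ξ₂}; E_{ξ₁}E_{ξ₃}* − E_{ξ₃}*E_{ξ₁}; E_{ξ₂}E_{ξ₃}* −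 q⁻²E_{ξ₃}*E_{ξ₂}. -/
noncomputable section

open scoped TensorProduct RealInnerProductSpace

variable {q : ℝ} {U : Type} [Ring U] [Algebra ℝ U]

/-- Abstract computation: all six relations from elementary commutation rules. -/
theorem abstract_relations (q t : ℝ) (hq : q ≠ 0) (ht0 : t ≠ 0) (ht : t = q + q⁻¹)
    (S : Subalgebra ℝ U) (a b x y u v c z d w : U)
    (ha : a ∈ S) (hx : x ∈ S) (hv : v ∈ S)
    (hax : a * x = (q⁻¹ ^ 2) • (x * a) + u)
    (hby : b * y = (q⁻¹ ^ 4) • (y * b) + v)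
    (hbx : b * x = (q ^ 2) • (x * b))
    (hay : a * y = (q ^ 2) • (y * a))
    (hub : u * b = (q⁻¹ ^ 4) • (b * u) - (q⁻¹ ^ 2 * t) • b)
    (hua : u * a = (q ^ 4) • (a * u) + (q ^ 2 * t) • a)
    (hc : c = a * b - (q⁻¹ ^ 2) • (b * a))
    (hz : z = y * x - (q⁻¹ ^ 2) • (x * y))
    (hd : d = t⁻¹ • (a * c - c * a))
    (hw : w = t⁻¹ • (z * x - x * z)) :
    (d * w - (q⁻¹ ^ 4) • (w * d) + ((q - q⁻¹) * q⁻¹ ^ 2) • (z * c)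
        - ((q - q⁻¹) ^ 2 * t * q⁻¹ ^ 3) • (y * b) ∈ S) ∧
      (c * z - (q⁻¹ ^ 2) • (z * c) + ((q - q⁻¹) * t ^ 2 * q⁻¹ ^ 4) • (y * b) ∈ S) ∧
      (b * y - (q⁻¹ ^ 4) • (y * b) ∈ S) ∧
      (d * z - (q⁻¹ ^ 2) • (z * d) + ((q - q⁻¹) * t * q⁻¹ ^ 2) • (y * c) ∈ S) ∧
      (d * y - y * d ∈ S) ∧
      (c * y - (q⁻¹ ^ 2) • (y * c) ∈ S) := by
  have huc : u * c = c * u := by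
    have e1 : u * (a * b) = (a * b) * u + 0 := by
      rw [← mul_assoc, hua]
      simp only [add_mul, smul_mul_assoc, mul_assoc, hub, mul_sub, mul_smul_comm, smul_sub,
        smul_smul]
      match_scalars <;> field_simp <;> ring
    have e2 : u * (b * a) = (b * a) * u + 0 := by
      rw [← mul_assoc, hub]
      simp only [sub_mul, smul_mul_assoc, mul_assoc, hua, mul_add, mul_smul_comm, smul_add,
        smul_smul]
      match_scalars <;> field_simp <;> ring
    rw [hc, mul_sub, mul_smul_comm, e1, e2]
    simp only [sub_mul, smul_mul_assoc, add_zero]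
  have hcx : c * x = x * c - t • b := by
    have e1 : a * b * x = x * (a * b) + (q ^ 2) • (u * b) := by
      rw [mul_assoc, hbx, mul_smul_comm, ← mul_assoc, hax]
      simp only [add_mul, smul_mul_assoc, mul_assoc]
      match_scalars <;> field_simp
    have e2 : b * a * x = x * (b * a) + b * u := by
      rw [mul_assoc, hax, mul_add, mul_smul_comm, ← mul_assoc, hbx]
      simp only [smul_mul_assoc, mul_assoc]
      match_scalars <;> field_simp
    rw [hc, sub_mul, smul_mul_assoc, e1, e2, hub, mul_sub, mul_smul_comm]
    match_scalars <;> field_simp <;> ring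
  have hac : a * c = t • d + c * a := by
    rw [hd, smul_smul, mul_inv_cancel₀ ht0, one_smul]; abel
  have hzx : z * x = t • w + x * z := by
    rw [hw, smul_smul, mul_inv_cancel₀ ht0, one_smul]; abel
  have hdx : d * x = (q⁻¹ ^ 2) • (x * d) - c := by
    have e1 : a * c * x = (q⁻¹ ^ 2) • (x * (a * c)) + u * c - t • (a * b) := by
      rw [mul_assoc, hcx, mul_sub, ← mul_assoc, hax]
      simp only [add_mul, smul_mul_assoc, mul_assoc, mul_smul_comm]
    have e2 : c * a * x = (q⁻¹ ^ 2) • (x * (c * a)) - (q⁻¹ ^ 2 * t) • (b * a) + c * u := by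
      rw [mul_assoc, hax, mul_add, mul_smul_comm, ← mul_assoc, hcx]
      simp only [sub_mul, smul_mul_assoc, mul_assoc, smul_sub, smul_smul]
    have e3 : c = a * b - (q⁻¹ ^ 2) • (b * a) := hc
    have e4 : d * x = t⁻¹ • (a * c * x - c * a * x) := by
      rw [hd, smul_mul_assoc, sub_mul]
    have e5 : x * d = t⁻¹ • (x * (a * c) - x * (c * a)) := by
      rw [hd, mul_smul_comm, mul_sub]
    rw [e4, e5, e1, e2, huc]
    generalize x * (a * c) = m1
    generalize x * (c * a) = m2
    generalize c * u = m3
    rw [e3]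
    match_scalars <;> field_simp <;> ring
  obtain ⟨s, hsS, hcy⟩ : ∃ s ∈ S, c * y = (q⁻¹ ^ 2) • (y * c) + s := by
    refine ⟨a * v - v * a, S.sub_mem (S.mul_mem ha hv) (S.mul_mem hv ha), ?_⟩
    have e1 : a * b * y = (q⁻¹ ^ 2) • (y * (a * b)) + a * v := by
      rw [mul_assoc, hby, mul_add, mul_smul_comm, ← mul_assoc, hay]
      simp only [smul_mul_assoc, mul_assoc]
      match_scalars <;> field_simp
    have e2 : b * a * y = (q⁻¹ ^ 2) • (y * (b * a)) + (q ^ 2) • (v * a) := by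
      rw [mul_assoc, hay, mul_smul_comm, ← mul_assoc, hby]
      simp only [add_mul, smul_mul_assoc, mul_assoc]
      match_scalars <;> field_simp
    rw [hc, sub_mul, smul_mul_assoc, e1, e2, mul_sub, mul_smul_comm]
    match_scalars <;> field_simp
  obtain ⟨r, hrS, hdy⟩ : ∃ r ∈ S, d * y = y * d + r := by
    refine ⟨t⁻¹ • (a * s - (q ^ 2) • (s * a)), S.smul_mem (S.sub_mem (S.mul_mem ha hsS)
      (S.smul_mem (S.mul_mem hsS ha) _)) _, ?_⟩
    have e1 : a * c * y = y * (a * c) + a * s := by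
      rw [mul_assoc, hcy, mul_add, mul_smul_comm, ← mul_assoc, hay]
      simp only [smul_mul_assoc, mul_assoc]
      match_scalars <;> field_simp
    have e2 : c * a * y = y * (c * a) + (q ^ 2) • (s * a) := by
      rw [mul_assoc, hay, mul_smul_comm, ← mul_assoc, hcy]
      simp only [add_mul, smul_mul_assoc, mul_assoc]
      match_scalars <;> field_simp
    rw [hd, smul_mul_assoc, sub_mul, e1, e2, mul_smul_comm, mul_sub]
    match_scalars <;> field_simp
  obtain ⟨k, hkS, hcz⟩ : ∃ k ∈ S, c * z = (q⁻¹ ^ 2) • (z * c)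
      - ((q - q⁻¹) * t ^ 2 * q⁻¹ ^ 4) • (y * b) + k := by
    refine ⟨s * x - (q⁻¹ ^ 2) • (x * s) + (q⁻¹ ^ 2 * t) • v, S.add_mem (S.sub_mem
      (S.mul_mem hsS hx) (S.smul_mem (S.mul_mem hx hsS) _)) (S.smul_mem hv _), ?_⟩
    have e1 : c * (y * x) = (q⁻¹ ^ 2) • (y * (x * c)) - (q⁻¹ ^ 2 * t) • (y * b) + s * x := by
      rw [← mul_assoc, hcy, add_mul, smul_mul_assoc, mul_assoc, hcx, mul_sub, mul_smul_comm]
      match_scalars <;> field_simp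
    have e2 : c * (x * y) = (q⁻¹ ^ 2) • (x * (y * c)) + x * s
        - (t * q⁻¹ ^ 4) • (y * b) - t • v := by
      rw [← mul_assoc, hcx, sub_mul, smul_mul_assoc, mul_assoc, hcy, hby, mul_add, mul_smul_comm]
      match_scalars <;> field_simp
    rw [hz, mul_sub, mul_smul_comm, e1, e2]
    simp only [sub_mul, smul_mul_assoc, mul_assoc]
    subst ht
    match_scalars <;> field_simp <;> ring
  obtain ⟨l, hlS, hdz⟩ : ∃ l ∈ S, d * z = (q⁻¹ ^ 2) • (z * d)
      - ((q - q⁻¹) * t * q⁻¹ ^ 2) • (y * c) + l := by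
    refine ⟨r * x - (q⁻¹ ^ 4) • (x * r) + (q⁻¹ ^ 2) • s, S.add_mem (S.sub_mem
      (S.mul_mem hrS hx) (S.smul_mem (S.mul_mem hx hrS) _)) (S.smul_mem hsS _), ?_⟩
    have e1 : d * (y * x) = (q⁻¹ ^ 2) • (y * (x * d)) - y * c + r * x := by
      rw [← mul_assoc, hdy, add_mul, mul_assoc, hdx, mul_sub, mul_smul_comm]
    have e2 : d * (x * y) = (q⁻¹ ^ 2) • (x * (y * d)) + (q⁻¹ ^ 2) • (x * r)
        - (q⁻¹ ^ 2) • (y * c) - s := by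
      rw [← mul_assoc, hdx, sub_mul, smul_mul_assoc, mul_assoc, hdy, hcy, mul_add]
      match_scalars <;> field_simp
    rw [hz, mul_sub, mul_smul_comm, e1, e2]
    simp only [sub_mul, smul_mul_assoc, mul_assoc]
    subst ht
    match_scalars <;> field_simp <;> ring
  refine ⟨?_, ?_, ?_, ?_, ?_, ?_⟩
  · have key : d * w - (q⁻¹ ^ 4) • (w * d) + ((q - q⁻¹) * q⁻¹ ^ 2) • (z * c)
        - ((q - q⁻¹) ^ 2 * t * q⁻¹ ^ 3) • (y * b)
        = t⁻¹ • (l * x - (q⁻¹ ^ 2) • (x * l) + k) := by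
      have e1 : d * (z * x) = (q⁻¹ ^ 4) • (z * (x * d)) - (q⁻¹ ^ 2) • (z * c)
          - ((q - q⁻¹) * t * q⁻¹ ^ 2) • (y * (x * c))
          + ((q - q⁻¹) * t ^ 2 * q⁻¹ ^ 2) • (y * b) + l * x := by
        rw [← mul_assoc, hdz]
        simp only [add_mul, sub_mul, smul_mul_assoc, mul_assoc, hdx, hcx, mul_sub, mul_smul_comm]
        match_scalars <;> field_simp
      have e2 : d * (x * z) = (q⁻¹ ^ 4) • (x * (z * d))
          - ((q - q⁻¹) * t * q⁻¹ ^ 4) • (x * (y * c)) + (q⁻¹ ^ 2) • (x * l)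
          - (q⁻¹ ^ 2) • (z * c) + ((q - q⁻¹) * t ^ 2 * q⁻¹ ^ 4) • (y * b) - k := by
        rw [← mul_assoc, hdx, sub_mul, smul_mul_assoc, mul_assoc, hdz, hcz]
        simp only [mul_add, mul_sub, mul_smul_comm]
        match_scalars <;> field_simp
      have e3 : z * c = y * (x * c) - (q⁻¹ ^ 2) • (x * (y * c)) := by
        rw [hz, sub_mul, smul_mul_assoc, mul_assoc, mul_assoc]
      have e4 : w * d = t⁻¹ • (z * (x * d) - x * (z * d)) := by
        rw [hw, smul_mul_assoc, sub_mul, mul_assoc, mul_assoc]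
      have e5 : d * w = t⁻¹ • (d * (z * x) - d * (x * z)) := by
        rw [hw, mul_smul_comm, mul_sub]
      rw [e5, e4, e1, e2, e3]
      generalize z * (x * d) = m1
      generalize x * (z * d) = m2
      have hne : q ^ 2 + 1 ≠ 0 := by positivity
      subst ht
      match_scalars <;> field_simp <;> ring
    rw [key]
    exact S.smul_mem (S.add_mem (S.sub_mem (S.mul_mem hlS hx)
      (S.smul_mem (S.mul_mem hx hlS) _)) hkS) _
  · rw [hcz]; convert hkS using 1; abel
  · rw [hby]; convert hv using 1; abel
  · rw [hdz]; convert hlS using 1; abel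
  · rw [hdy]; convert hrS using 1; abel
  · rw [hcy]; convert hsS using 1; abel

/-- six combinations of products of the radical root vectors
`E_{ξ₁} = E_{β₂}`, `E_{ξ₂} = E_{β₃}`, `E_{ξ₃} = E_{β₄}` and their stars belong to
the quantized Levi factor `U_q(𝔩)`. -/
theorem relations_modulo_levi (hq0 : 0 < q) (hq1 : q < 1) (g : Sp4Gens q U) :
    (Eb2 g * sEb2 g - (q ^ (-4 : ℤ)) • (sEb2 g * Eb2 g)
        + ((q - q⁻¹) * q ^ (-2 : ℤ)) • (sEb3 g * Eb3 g)
        - ((q - q⁻¹) ^ 2 * qnum q 2 * q ^ (-3 : ℤ)) • (sEb4 g * Eb4 g) ∈ Uql g) ∧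
      (Eb3 g * sEb3 g - (q ^ (-2 : ℤ)) • (sEb3 g * Eb3 g)
        + ((q - q⁻¹) * qnum q 2 ^ 2 * q ^ (-4 : ℤ)) • (sEb4 g * Eb4 g) ∈ Uql g) ∧
      (Eb4 g * sEb4 g - (q ^ (-4 : ℤ)) • (sEb4 g * Eb4 g) ∈ Uql g) ∧
      (Eb2 g * sEb3 g - (q ^ (-2 : ℤ)) • (sEb3 g * Eb2 g)
        + ((q - q⁻¹) * qnum q 2 * q ^ (-2 : ℤ)) • (sEb4 g * Eb3 g) ∈ Uql g) ∧
      (Eb2 g * sEb4 g - sEb4 g * Eb2 g ∈ Uql g) ∧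
      (Eb3 g * sEb4 g - (q ^ (-2 : ℤ)) • (sEb4 g * Eb3 g) ∈ Uql g) := by
  have hq : q ≠ 0 := hq0.ne'
  have h1 : q - q⁻¹ ≠ 0 := by
    have : 1 < q⁻¹ := (one_lt_inv₀ hq0).2 hq1
    linarith
  have ht : qnum q 2 = q + q⁻¹ := by
    have e : q ^ (2 : ℤ) - q ^ (-2 : ℤ) = (q + q⁻¹) * (q - q⁻¹) := by
      rw [zpow_neg]; norm_cast; field_simp; ring
    rw [qnum, e, mul_div_assoc, div_self h1, mul_one]
  have ht0 : qnum q 2 ≠ 0 := by rw [ht]; positivity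
  have z2 : q ^ (-2 : ℤ) = q⁻¹ ^ 2 := by rw [zpow_neg, inv_pow]; norm_cast
  have z3 : q ^ (-3 : ℤ) = q⁻¹ ^ 3 := by rw [zpow_neg, inv_pow]; norm_cast
  have z4 : q ^ (-4 : ℤ) = q⁻¹ ^ 4 := by rw [zpow_neg, inv_pow]; norm_cast
  have p2 : q ^ (2 : ℤ) = q ^ 2 := by norm_cast
  have p4 : q ^ (4 : ℤ) = q ^ 4 := by norm_cast
  have hlam : qnum q 2 = (q ^ 2 - q⁻¹ ^ 2) * (q - q⁻¹)⁻¹ := by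
    rw [qnum, p2, z2, div_eq_mul_inv]
  have mem : ∀ m ∈ ({g.E1, g.F1, g.K1, g.K1i, g.K2, g.K2i} : Set U), m ∈ Uql g :=
    fun m hm => Algebra.subset_adjoin hm
  have mE1 : g.E1 ∈ Uql g := mem _ (by simp)
  have mF1 : g.F1 ∈ Uql g := mem _ (by simp)
  have mK1 : g.K1 ∈ Uql g := mem _ (by simp)
  have mK2 : g.K2 ∈ Uql g := mem _ (by simp)
  have rK1E1 := g.relK1E1
  have rK1E2 := g.relK1E2
  have rK2E1 := g.relK2E1
  have rK2E2 := g.relK2E2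
  have rE1F1 := g.relE1F1
  have rE2F2 := g.relE2F2
  rw [p2] at rK1E1
  rw [z2] at rK1E2 rK2E1
  rw [p4] at rK2E2
  rw [p2, z2] at rE2F2
  have hL1 : g.K1 * g.K1 * g.E1 = (q ^ 4) • (g.E1 * (g.K1 * g.K1)) := by
    rw [mul_assoc, rK1E1, mul_smul_comm, ← mul_assoc, rK1E1, smul_mul_assoc, mul_assoc, smul_smul]
    congr 1; ring
  have hL2 : g.K1 * g.K1 * g.E2 = (q⁻¹ ^ 4) • (g.E2 * (g.K1 * g.K1)) := by
    rw [mul_assoc, rK1E2, mul_smul_comm, ← mul_assoc, rK1E2, smul_mul_assoc, mul_assoc, smul_smul]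
    congr 1; ring
  simp only [z2, z3, z4]
  refine abstract_relations q (qnum q 2) hq ht0 ht (Uql g) g.E1 g.E2 (g.F1 * g.K1) (g.F2 * g.K2)
    ((q - q⁻¹)⁻¹ • (g.K1 * g.K1 - 1)) ((q ^ 2 - q⁻¹ ^ 2)⁻¹ • (g.K2 * g.K2 - 1))
    (Eb3 g) (sEb3 g) (Eb2 g) (sEb2 g) mE1 ((Uql g).mul_mem mF1 mK1)
    ((Uql g).smul_mem ((Uql g).sub_mem ((Uql g).mul_mem mK2 mK2) (Uql g).one_mem) _)
    ?_ ?_ ?_ ?_ ?_ ?_ ?_ ?_ ?_ ?_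
  · have e : g.E1 * g.F1 = g.F1 * g.E1 + (q - q⁻¹)⁻¹ • (g.K1 - g.K1i) := by rw [← rE1F1]; abel
    rw [← mul_assoc, e, add_mul, smul_mul_assoc, sub_mul, g.relK1', mul_assoc g.F1 g.K1, rK1E1,
      mul_smul_comm, smul_smul, mul_assoc]
    match_scalars <;> field_simp
  · have e : g.E2 * g.F2 = g.F2 * g.E2 + (q ^ 2 - q⁻¹ ^ 2)⁻¹ • (g.K2 - g.K2i) := by
      rw [← rE2F2]; abel
    rw [← mul_assoc, e, add_mul, smul_mul_assoc, sub_mul, g.relK2', mul_assoc g.F2 g.K2, rK2E2,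
      mul_smul_comm, smul_smul, mul_assoc]
    congr 1
    match_scalars; field_simp
  · rw [← mul_assoc, g.relE2F1, mul_assoc g.F1 g.K1, rK1E2, mul_smul_comm, smul_smul, mul_assoc]
    match_scalars; field_simp
  · rw [← mul_assoc, g.relE1F2, mul_assoc g.F2 g.K2, rK2E1, mul_smul_comm, smul_smul, mul_assoc]
    match_scalars; field_simp
  · rw [smul_mul_assoc, sub_mul, hL2, one_mul, mul_smul_comm, mul_sub, mul_one, hlam]
    generalize (q - q⁻¹)⁻¹ = lam
    match_scalars <;> field_simp <;> ring
  · rw [smul_mul_assoc, sub_mul, hL1, one_mul, mul_smul_comm, mul_sub, mul_one, hlam]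
    generalize (q - q⁻¹)⁻¹ = lam
    match_scalars <;> field_simp <;> ring
  · rw [Eb3, z2]
  · rw [sEb3, z2]
  · rw [Eb2, Eb3, z2]
    simp only [mul_sub, sub_mul, mul_smul_comm, smul_mul_assoc, pow_two g.E1, mul_assoc]
    have hne : q ^ 2 + 1 ≠ 0 := by positivity
    rw [ht]
    match_scalars <;> field_simp <;> ring
  · rw [sEb2, sEb3, z2]
    generalize g.F1 * g.K1 = x
    generalize g.F2 * g.K2 = y
    simp only [mul_sub, sub_mul, mul_smul_comm, smul_mul_assoc, pow_two x, mul_assoc]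
    have hne : q ^ 2 + 1 ≠ 0 := by positivity
    rw [ht]
    match_scalars <;> field_simp <;> ring
end
end
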